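/- arXiv:2003.13152 — 4 statements merged into one kernel-verified Lean document; each statement's English description precedes it below -/
import Mathlib

section
/- Let a, b be positive integers and suppose V ∈ Inc^ℓ(a × b) satisfies Frame(V) = Frame(Ψ(V)), where Ψ denotes K-promotion. Then V is the minimal tableau M_{a×b} and ℓ = a+b−1. -/
open scoped Classical

/-- Two boxes of the `a × b` grid are adjacent if they share an edge. -/
def Adj {a b : ℕ} (x y : Fin a × Fin b) : Prop :=
  (x.1 = y.1 ∧ ((x.2 : ℕ) + 1 = (y.2 : ℕ) ∨ (y.2 : ℕ) + 1 = (x.2 : ℕ))) ∨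
  (x.2 = y.2 ∧ ((x.1 : ℕ) + 1 = (y.1 : ℕ) ∨ (y.1 : ℕ) + 1 = (x.1 : ℕ)))

/-- `IncTab a b q T` says `T` is an increasing tableau of shape `a × b`
(rows strictly increase left-to-right, columns strictly increase top-to-bottom)
with positive entries, all at most `q`; i.e. `T ∈ Inc^q(a × b)`. -/
def IncTab (a b q : ℕ) (T : Fin a × Fin b → ℕ) : Prop :=
  (∀ x, 1 ≤ T x ∧ T x ≤ q) ∧
  (∀ (i : Fin a) (j₁ j₂ : Fin b), j₁ < j₂ → T (i, j₁) < T (i, j₂)) ∧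
  (∀ (i₁ i₂ : Fin a) (j : Fin b), i₁ < i₂ → T (i₁, j) < T (i₂, j))

/-- In the filling `f`, boxes `x` and `y` lie in a common edge-connected
component (short ribbon) of the set of boxes labeled `1` or `t`. -/
def SameRibbon {a b : ℕ} (t : ℕ) (f : Fin a × Fin b → ℕ) (x y : Fin a × Fin b) : Prop :=
  Relation.ReflTransGen
    (fun u v => Adj u v ∧ (f u = 1 ∨ f u = t) ∧ (f v = 1 ∨ f v = t)) x y

/-- One step of the K-promotion algorithm at value `t`: in every nontrivial
edge-connected component of the set of boxes labeled `1` or `t`, the labels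
`1` and `t` are swapped; boxes in trivial components are unchanged. -/
noncomputable def BKstep {a b : ℕ} (t : ℕ) (f : Fin a × Fin b → ℕ) :
    Fin a × Fin b → ℕ := fun x =>
  if ∃ y, y ≠ x ∧ SameRibbon t f x y then
    (if f x = 1 then t else if f x = t then 1 else f x)
  else f x

/-- The intermediate filling obtained from `f` after performing the swap steps
for the values `2, 3, …, t - 1` (so `sweepUpTo t f` is the filling in force
when the step for value `t` is about to be performed). -/
noncomputable def sweepUpTo {a b : ℕ} (t : ℕ) (f : Fin a × Fin b → ℕ) :
    Fin a × Fin b → ℕ :=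
  (List.range' 2 (t - 2)).foldl (fun g s => BKstep s g) f

/-- K-promotion `Ψ : Inc^q(a × b) → Inc^q(a × b)`: perform the swap steps for
`t = 2, …, q`, then decrement every entry by `1`, replacing a resulting `0`
by `q`. -/
noncomputable def KPro {a b : ℕ} (q : ℕ) (T : Fin a × Fin b → ℕ) :
    Fin a × Fin b → ℕ := fun x =>
  if sweepUpTo (q + 1) T x = 1 then q else sweepUpTo (q + 1) T x - 1

/-- The Ψ-orbit of `T` under K-promotion. -/
noncomputable def PsiOrbit {a b : ℕ} (q : ℕ) (T : Fin a × Fin b → ℕ) :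
    Set (Fin a × Fin b → ℕ) :=
  {U | ∃ n : ℕ, (KPro q)^[n] T = U}

/-- The pair `{x, y}` of adjacent boxes belongs to the flow path of `V`:
at the step for some value `t ∈ {2, …, q}`, both boxes carry label `1` or `t`,
so they form part of a common nontrivial short ribbon whose labels are swapped. -/
def FlowPath {a b : ℕ} (q : ℕ) (V : Fin a × Fin b → ℕ) (x y : Fin a × Fin b) : Prop :=
  Adj x y ∧ ∃ t, 2 ≤ t ∧ t ≤ q ∧
    (sweepUpTo t V x = 1 ∨ sweepUpTo t V x = t) ∧
    (sweepUpTo t V y = 1 ∨ sweepUpTo t V y = t)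

/-- The stream-bed of `V`: boxes appearing in some pair of the flow path. -/
def StreamBed {a b : ℕ} (q : ℕ) (V : Fin a × Fin b → ℕ) (x : Fin a × Fin b) : Prop :=
  ∃ y, FlowPath q V x y ∨ FlowPath q V y x

/-- The box `x` lies in the frame of the `a × b` grid (first or last row,
or first or last column). -/
def InFrame {a b : ℕ} (x : Fin a × Fin b) : Prop :=
  (x.1 : ℕ) = 0 ∨ (x.1 : ℕ) = a - 1 ∨ (x.2 : ℕ) = 0 ∨ (x.2 : ℕ) = b - 1

/-- `Frame(V) = Frame(W)`: the fillings agree on all frame boxes. -/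
def FrameEq {a b : ℕ} (V W : Fin a × Fin b → ℕ) : Prop :=
  ∀ x, InFrame x → V x = W x

/-- The minimal tableau `M_{a×b}`, with entries `M(i,j) = i + j - 1`
(in 1-based coordinates; here coordinates are 0-based). -/
def MinTab (a b : ℕ) : Fin a × Fin b → ℕ := fun x => (x.1 : ℕ) + (x.2 : ℕ) + 1

def Nx {a b : ℕ} (x y : Fin a × Fin b) : Prop :=
  (x.1 = y.1 ∧ (x.2 : ℕ) + 1 = (y.2 : ℕ)) ∨ (x.2 = y.2 ∧ (x.1 : ℕ) + 1 = (y.1 : ℕ))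

lemma adj_iff_nx {a b : ℕ} (x y : Fin a × Fin b) : Adj x y ↔ Nx x y ∨ Nx y x := by
  unfold Adj Nx
  constructor
  · rintro (⟨h, h' | h'⟩ | ⟨h, h' | h'⟩)
    · exact Or.inl (Or.inl ⟨h, h'⟩)
    · exact Or.inr (Or.inl ⟨h.symm, h'⟩)
    · exact Or.inl (Or.inr ⟨h, h'⟩)
    · exact Or.inr (Or.inr ⟨h.symm, h'⟩)
  · rintro ((⟨h, h'⟩ | ⟨h, h'⟩) | (⟨h, h'⟩ | ⟨h, h'⟩))
    · exact Or.inl ⟨h, Or.inl h'⟩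
    · exact Or.inr ⟨h, Or.inl h'⟩
    · exact Or.inl ⟨h.symm, Or.inr h'⟩
    · exact Or.inr ⟨h.symm, Or.inr h'⟩

lemma nx_lt {a b q : ℕ} {V : Fin a × Fin b → ℕ} (hV : IncTab a b q V) {x y : Fin a × Fin b}
    (h : Nx x y) : V x < V y := by
  obtain ⟨x1, x2⟩ := x
  obtain ⟨y1, y2⟩ := y
  rcases h with ⟨h, h'⟩ | ⟨h, h'⟩
  · simp only at h h'
    subst h
    exact hV.2.1 _ _ _ (Fin.lt_def.2 (by omega))
  · simp only at h h'
    subst h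
    exact hV.2.2 _ _ _ (Fin.lt_def.2 (by omega))

/-- the stream: boxes that hold a `1` at some time -/
inductive Strm {a b : ℕ} (V : Fin a × Fin b → ℕ) : Fin a × Fin b → Prop
  | base (x) (h : V x = 1) : Strm V x
  | step (p x) (hp : Strm V p) (h : Nx p x) (hm : ∀ z, Nx p z → V x ≤ V z) : Strm V x

structure SInv {a b : ℕ} (V : Fin a × Fin b → ℕ) (t : ℕ) (f : Fin a × Fin b → ℕ) : Prop where
  h0 : ∀ x, ¬ Strm V x → f x = V x
  h1 : ∀ x, t ≤ V x → f x = V x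
  h2 : ∀ x, Strm V x → V x < t → (∀ y, Nx x y → t ≤ V y) → f x = 1
  h3 : ∀ x, Strm V x → V x < t → ∀ y, Nx x y → V y < t → (∀ z, Nx x z → V y ≤ V z) → f x = V y

lemma exists_min_nx {a b : ℕ} (V : Fin a × Fin b → ℕ) (x : Fin a × Fin b)
    (h : ∃ y, Nx x y) : ∃ y, Nx x y ∧ ∀ z, Nx x z → V y ≤ V z := by
  obtain ⟨y, hy, hm⟩ := Set.exists_min_image {y | Nx x y} V (Set.toFinite _) h
  exact ⟨y, hy, hm⟩

lemma nontriv_iff {a b : ℕ} (t : ℕ) (f : Fin a × Fin b → ℕ) (x : Fin a × Fin b) :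
    (∃ y, y ≠ x ∧ SameRibbon t f x y) ↔
      ∃ y, Adj x y ∧ (f x = 1 ∨ f x = t) ∧ (f y = 1 ∨ f y = t) := by
  constructor
  · rintro ⟨y, hne, h⟩
    rcases Relation.ReflTransGen.cases_head h with h | ⟨c, hc, -⟩
    · exact absurd h.symm hne
    · exact ⟨c, hc⟩
  · rintro ⟨y, hy⟩
    refine ⟨y, ?_, Relation.ReflTransGen.single hy⟩
    rintro rfl
    rcases hy.1 with ⟨_, h | h⟩ | ⟨_, h | h⟩ <;> omega

lemma sinv_trichotomy {a b : ℕ} (V : Fin a × Fin b → ℕ) (t : ℕ) (x : Fin a × Fin b) :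
    (¬ Strm V x ∨ t ≤ V x) ∨ (Strm V x ∧ V x < t ∧ ∀ y, Nx x y → t ≤ V y) ∨
    (Strm V x ∧ V x < t ∧ ∃ y, Nx x y ∧ V y < t ∧ ∀ z, Nx x z → V y ≤ V z) := by
  by_cases hs : Strm V x
  · by_cases ht : t ≤ V x
    · exact Or.inl (Or.inr ht)
    · by_cases h : ∀ y, Nx x y → t ≤ V y
      · exact Or.inr (Or.inl ⟨hs, by omega, h⟩)
      · push Not at h
        obtain ⟨y, hy, hyt⟩ := h
        obtain ⟨z, hz, hm⟩ := exists_min_nx V x ⟨y, hy⟩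
        exact Or.inr (Or.inr ⟨hs, by omega, z, hz, by have := hm y hy; omega, hm⟩)
  · exact Or.inl (Or.inl hs)

lemma sinv_one {a b q t : ℕ} {V f : Fin a × Fin b → ℕ} (hV : IncTab a b q V) (ht : 2 ≤ t)
    (h : SInv V t f) (x : Fin a × Fin b) :
    f x = 1 ↔ (Strm V x ∧ V x < t ∧ ∀ y, Nx x y → t ≤ V y) := by
  constructor
  · intro h1
    rcases sinv_trichotomy V t x with (hc | hc) | hc | ⟨hs, hx, y, hy, hyt, hm⟩
    · exact absurd (Strm.base x (by rw [← h.h0 x hc, h1])) hc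
    · have := h.h1 x hc
      omega
    · exact hc
    · have := h.h3 x hs hx y hy hyt hm
      have := nx_lt hV hy
      have := (hV.1 x).1
      omega
  · rintro ⟨hs, hx, hy⟩
    exact h.h2 x hs hx hy

lemma sinv_t {a b t : ℕ} {V f : Fin a × Fin b → ℕ} (ht : 2 ≤ t)
    (h : SInv V t f) (x : Fin a × Fin b) : f x = t ↔ V x = t := by
  constructor
  · intro h1
    rcases sinv_trichotomy V t x with (hc | hc) | ⟨hs, hx, hy⟩ | ⟨hs, hx, y, hy, hyt, hm⟩
    · rw [← h.h0 x hc, h1]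
    · rw [← h.h1 x hc, h1]
    · have := h.h2 x hs hx hy
      omega
    · have := h.h3 x hs hx y hy hyt hm
      omega
  · intro h1
    rw [h.h1 x h1.ge, h1]

lemma sinv_step {a b q t : ℕ} {V f : Fin a × Fin b → ℕ} (hV : IncTab a b q V) (ht : 2 ≤ t)
    (h : SInv V t f) : SInv V (t + 1) (BKstep t f) := by
  have h1 := sinv_one hV ht h
  have hT := sinv_t ht h
  -- boxes with other labels do not change
  have key0 : ∀ x, f x ≠ 1 → f x ≠ t → BKstep t f x = f x := by
    intro x hx hx'
    simp [BKstep, hx, hx']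
  have key1 : ∀ x, f x = 1 → (∃ y, Nx x y ∧ V y = t) → BKstep t f x = t := by
    rintro x hx ⟨y, hy, hyt⟩
    unfold BKstep
    rw [if_pos ((nontriv_iff t f x).2
      ⟨y, (adj_iff_nx _ _).2 (Or.inl hy), Or.inl hx, Or.inr ((hT y).2 hyt)⟩), if_pos hx]
  have key2 : ∀ x, f x = 1 → (¬ ∃ y, Nx x y ∧ V y = t) → BKstep t f x = 1 := by
    intro x hx hn
    unfold BKstep
    rw [if_neg, hx]
    rw [nontriv_iff]
    rintro ⟨y, hadj, -, hy⟩
    obtain ⟨hs, hxt, hm⟩ := (h1 x).1 hx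
    rcases (adj_iff_nx _ _).1 hadj with hxy | hyx
    · rcases hy with hy | hy
      · have := ((h1 y).1 hy).2.1
        have := hm y hxy
        omega
      · exact hn ⟨y, hxy, (hT y).1 hy⟩
    · have hlt := nx_lt hV hyx
      rcases hy with hy | hy
      · have := ((h1 y).1 hy).2.2 x hyx
        omega
      · have := (hT y).1 hy
        omega
  have key3 : ∀ x, V x = t → Strm V x → BKstep t f x = 1 := by
    intro x hx hs
    have hfx := (hT x).2 hx
    cases hs with
    | base _ h => omega
    | step p _ hp hpx hm =>
      have hlt := nx_lt hV hpx
      have hfp : f p = 1 := (h1 p).2 ⟨hp, by omega, fun y hy => by rw [← hx]; exact hm y hy⟩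
      unfold BKstep
      rw [if_pos ((nontriv_iff t f x).2
        ⟨p, (adj_iff_nx _ _).2 (Or.inr hpx), Or.inr hfx, Or.inl hfp⟩), if_neg (by omega),
        if_pos hfx]
  have key4 : ∀ x, V x = t → ¬ Strm V x → BKstep t f x = t := by
    intro x hx hs
    have hfx := (hT x).2 hx
    unfold BKstep
    rw [if_neg, hfx]
    rw [nontriv_iff]
    rintro ⟨y, hadj, -, hy⟩
    have hne : V y < t → Nx y x := by
      intro hlt
      rcases (adj_iff_nx _ _).1 hadj with hxy | hyx
      · have := nx_lt hV hxy
        omega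
      · exact hyx
    rcases hy with hy | hy
    · obtain ⟨hys, hyt, hm⟩ := (h1 y).1 hy
      exact hs (Strm.step y x hys (hne hyt) (fun z hz => by rw [hx]; exact hm z hz))
    · have hy' := (hT y).1 hy
      rcases (adj_iff_nx _ _).1 hadj with hxy | hyx
      · have := nx_lt hV hxy
        omega
      · have := nx_lt hV hyx
        omega
  constructor
  · intro x hs
    by_cases hx : V x = t
    · rw [key4 x hx hs, hx]
    · rw [key0 x (fun hc => hs ((h1 x).1 hc).1) (fun hc => hx ((hT x).1 hc)), h.h0 x hs]
  · intro x hx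
    have := h.h1 x (by omega)
    rw [key0 x (by omega) (by omega), this]
  · intro x hs hx hm
    by_cases hxt : V x = t
    · exact key3 x hxt hs
    · apply key2 x ((h1 x).2 ⟨hs, by omega, fun y hy => by have := hm y hy; omega⟩)
      rintro ⟨y, hy, hyt⟩
      have := hm y hy
      omega
  · intro x hs hx y hy hyt hm
    have hlt := nx_lt hV hy
    by_cases hyt' : V y = t
    · rw [key1 x ((h1 x).2 ⟨hs, by omega, fun z hz => by have := hm z hz; omega⟩) ⟨y, hy, hyt'⟩,
        hyt']
    · have := h.h3 x hs (by omega) y hy (by omega) hm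
      have := (hV.1 x).1
      rw [key0 x (by omega) (by omega)]
      assumption

lemma sinv_sweep {a b q : ℕ} {V : Fin a × Fin b → ℕ} (hV : IncTab a b q V) (n : ℕ) :
    SInv V (n + 2) (sweepUpTo (n + 2) V) := by
  induction n with
  | zero =>
    have : sweepUpTo (0 + 2) V = V := by simp [sweepUpTo]
    rw [this]
    refine ⟨fun _ _ => rfl, fun _ _ => rfl, ?_, ?_⟩
    · intro x _ hx _
      have := (hV.1 x).1
      omega
    · intro x _ hx y hy hyt _
      have := nx_lt hV hy
      have := (hV.1 x).1
      omega
  | succ n ih =>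
    have : sweepUpTo (n + 1 + 2) V = BKstep (n + 2) (sweepUpTo (n + 2) V) := by
      simp [sweepUpTo, List.range'_concat, Nat.add_comm]
    rw [this]
    exact sinv_step hV (by omega) ih

/-- **Proposition 3.2.** Suppose `V ∈ Inc^ℓ(a × b)` satisfies
`Frame(V) = Frame(Ψ(V))`. Then `V` is the minimal tableau `M_{a×b}` and
`ℓ = a + b - 1`. -/
theorem frame_fixed_implies_minimal (a b : ℕ) (ha : 0 < a) (hb : 0 < b)
    (ℓ : ℕ) (V : Fin a × Fin b → ℕ) (hV : IncTab a b ℓ V)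
    (hframe : FrameEq V (KPro ℓ V)) :
    V = MinTab a b ∧ ℓ = a + b - 1 := by
  have hl : 1 ≤ ℓ := le_trans (hV.1 (⟨0, ha⟩, ⟨0, hb⟩)).1 (hV.1 (⟨0, ha⟩, ⟨0, hb⟩)).2
  obtain ⟨n, rfl⟩ : ∃ n, ℓ = n + 1 := ⟨ℓ - 1, by omega⟩
  have hI := sinv_sweep hV n
  have hF : ∀ x, InFrame x → V x =
      if sweepUpTo (n + 2) V x = 1 then n + 1 else sweepUpTo (n + 2) V x - 1 := hframe
  have hle : ∀ x, V x < n + 2 := fun x => by have := (hV.1 x).2; omega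
  have hS : ∀ x, InFrame x → Strm V x := by
    intro x hx
    by_contra hs
    have h1 := hF x hx
    have h2 := (hV.1 x).1
    rw [hI.h0 x hs] at h1
    by_cases h3 : V x = 1
    · exact hs (Strm.base x h3)
    · rw [if_neg h3] at h1
      omega
  have hM : ∀ x y, InFrame x → Nx x y → (∀ z, Nx x z → V y ≤ V z) → V y = V x + 1 := by
    intro x y hx hy hm
    have h1 := hF x hx
    have h2 := (hV.1 x).1
    have h3 := nx_lt hV hy
    rw [hI.h3 x (hS x hx) (hle x) y hy (hle y) hm, if_neg (by omega)] at h1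
    omega
  have hcol : ∀ i (hi : i < a), V (⟨i, hi⟩, ⟨0, hb⟩) = i + 1 := by
    intro i
    induction i with
    | zero =>
      intro hi
      cases hS (⟨0, hi⟩, ⟨0, hb⟩) (Or.inl rfl) with
      | base _ h => simpa using h
      | step p _ hp hpx hm =>
        rcases hpx with ⟨_, h⟩ | ⟨_, h⟩ <;> simp at h
    | succ i ih =>
      intro hi
      have hi' : i < a := by omega
      have hnx : Nx ((⟨i, hi'⟩, ⟨0, hb⟩) : Fin a × Fin b) (⟨i + 1, hi⟩, ⟨0, hb⟩) :=
        Or.inr ⟨rfl, rfl⟩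
      cases hS (⟨i + 1, hi⟩, ⟨0, hb⟩) (Or.inr (Or.inr (Or.inl rfl))) with
      | base _ h =>
        have := nx_lt hV hnx
        have := ih hi'
        omega
      | step p _ hp hpx hm =>
        have hpe : p = (⟨i, hi'⟩, ⟨0, hb⟩) := by
          obtain ⟨p1, p2⟩ := p
          rcases hpx with ⟨_, h⟩ | ⟨h, h'⟩
          · simp at h
          · simp only at h h'
            subst h
            congr 1
            exact Fin.ext (by simp; omega)
        subst hpe
        rw [hM _ _ (Or.inr (Or.inr (Or.inl rfl))) hpx hm, ih hi']
  have ha' : a - 1 < a := by omega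
  have hrow : ∀ j (hj : j < b), V (⟨a - 1, ha'⟩, ⟨j, hj⟩) = a + j := by
    intro j
    induction j with
    | zero =>
      intro hj
      rw [hcol]
      omega
    | succ j ih =>
      intro hj
      rw [hM (⟨a - 1, ha'⟩, ⟨j, by omega⟩) (⟨a - 1, ha'⟩, ⟨j + 1, hj⟩) (Or.inr (Or.inl rfl)) (Or.inl ⟨rfl, rfl⟩), ih]
      · omega
      · rintro ⟨z1, z2⟩ (⟨h, h'⟩ | ⟨h, h'⟩)
        · simp only at h h'
          subst h
          have : z2 = ⟨j + 1, hj⟩ := Fin.ext h'.symm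
          rw [this]
        · have := z1.2
          simp only at h'
          omega
  have hb' : b - 1 < b := by omega
  have hcorner : V (⟨a - 1, ha'⟩, ⟨b - 1, hb'⟩) = n + 1 := by
    have hfr : InFrame ((⟨a - 1, ha'⟩, ⟨b - 1, hb'⟩) : Fin a × Fin b) := Or.inr (Or.inl rfl)
    have h1 := hF _ hfr
    rw [hI.h2 _ (hS _ hfr) (hle _), if_pos rfl] at h1
    · exact h1
    · rintro ⟨z1, z2⟩ (⟨h, h'⟩ | ⟨h, h'⟩)
      · have := z2.2
        simp only at h'
        omega
      · have := z1.2
        simp only at h'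
        omega
  have hlow : ∀ i (hi : i < a) j (hj : j < b), i + j + 1 ≤ V (⟨i, hi⟩, ⟨j, hj⟩) := by
    intro i hi j
    induction j with
    | zero =>
      intro hj
      rw [hcol]
    | succ j ih =>
      intro hj
      have h1 := ih (by omega)
      have h2 := nx_lt hV (x := (⟨i, hi⟩, ⟨j, by omega⟩)) (y := (⟨i, hi⟩, ⟨j + 1, hj⟩))
        (Or.inl ⟨rfl, rfl⟩)
      omega
  have hup : ∀ k i (hi : i < a) j (hj : j < b), i + k + 1 = a →
      V (⟨i, hi⟩, ⟨j, hj⟩) ≤ i + j + 1 := by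
    intro k
    induction k with
    | zero =>
      intro i hi j hj hk
      obtain rfl : i = a - 1 := by omega
      rw [hrow]
      omega
    | succ k ih =>
      intro i hi j hj hk
      have h1 := ih (i + 1) (by omega) j hj (by omega)
      have h2 := nx_lt hV (x := (⟨i, hi⟩, ⟨j, hj⟩)) (y := (⟨i + 1, by omega⟩, ⟨j, hj⟩))
        (Or.inr ⟨rfl, rfl⟩)
      omega
  constructor
  · funext x
    obtain ⟨⟨i, hi⟩, ⟨j, hj⟩⟩ := x
    have h1 := hlow i hi j hj
    have h2 := hup (a - 1 - i) i hi j hj (by omega)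
    simp only [MinTab]
    omega
  · rw [hrow] at hcorner
    omega
end

section
/- Let a, b be positive integers and suppose V ∈ Inc^ℓ(a × b) satisfies Frame(V) = Frame(Ψ(V)), where Ψ denotes K-promotion. Then V(1,1) = 1 and V(a,b) = ℓ. -/
open scoped Classical

def Cov {a b : ℕ} (u v : Fin a × Fin b) : Prop :=
  (u.1 = v.1 ∧ (u.2 : ℕ) + 1 = (v.2 : ℕ)) ∨ (u.2 = v.2 ∧ (u.1 : ℕ) + 1 = (v.1 : ℕ))

theorem adj_iff {a b : ℕ} (u v : Fin a × Fin b) : Adj u v ↔ Cov u v ∨ Cov v u := by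
  unfold Adj Cov
  constructor
  · rintro (⟨h, h1 | h1⟩ | ⟨h, h1 | h1⟩) <;> simp [h, h1]
  · rintro ((⟨h, h1⟩ | ⟨h, h1⟩) | (⟨h, h1⟩ | ⟨h, h1⟩)) <;> simp [h, h1]

def KInv {a b : ℕ} (t : ℕ) (f : Fin a × Fin b → ℕ) : Prop :=
  (∀ x, 1 ≤ f x) ∧ ∀ u v, Cov u v → (f u = 1 → t ≤ f v) ∧ (f v = 1 → 1 < f u ∧ f u < t) ∧
    (f u ≠ 1 → f v ≠ 1 → f u < f v)

theorem BK_cases {a b : ℕ} (t : ℕ) (ht : 2 ≤ t) (f : Fin a × Fin b → ℕ) (hf : KInv t f)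
    (x : Fin a × Fin b) : BKstep t f x = f x ∨
      (∃ z, f x = 1 ∧ BKstep t f x = t ∧ f z = t) ∨
      (∃ z, f x = t ∧ BKstep t f x = 1 ∧ f z = 1) := by
  by_cases h : ∃ y, y ≠ x ∧ SameRibbon t f x y
  · right
    have hB : BKstep t f x = (if f x = 1 then t else if f x = t then 1 else f x) := by
      unfold BKstep; rw [if_pos h]
    obtain ⟨y, hy, hr⟩ := h
    rcases Relation.ReflTransGen.cases_head hr with h0 | ⟨z, ⟨hA, hx, hz⟩, -⟩
    · exact absurd h0.symm hy
    · have hne : f x ≠ f z := by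
        rcases (adj_iff x z).1 hA with hc | hc
        · have := hf.2 _ _ hc
          grind
        · have := hf.2 _ _ hc
          grind
      rcases hx with hx | hx
      · left; refine ⟨z, hx, ?_, ?_⟩
        · rw [hB, if_pos hx]
        · grind
      · right; refine ⟨z, hx, ?_, ?_⟩
        · rw [hB, if_neg (by omega), if_pos hx]
        · grind
  · left; unfold BKstep; rw [if_neg h]

theorem BK_swap {a b : ℕ} (t : ℕ) (f : Fin a × Fin b → ℕ)
    (u v : Fin a × Fin b) (hc : Cov u v) (ht : 2 ≤ t) (hu : f u = 1) (hv : f v = t) :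
    BKstep t f u = t ∧ BKstep t f v = 1 := by
  have hne : u ≠ v := by rintro rfl; omega
  constructor
  · unfold BKstep
    rw [if_pos, if_pos hu]
    exact ⟨v, hne.symm, Relation.ReflTransGen.single
      ⟨(adj_iff _ _).2 (Or.inl hc), Or.inl hu, Or.inr hv⟩⟩
  · unfold BKstep
    rw [if_pos, if_neg (by omega), if_pos hv]
    exact ⟨u, hne, Relation.ReflTransGen.single
      ⟨(adj_iff _ _).2 (Or.inr hc), Or.inr hv, Or.inl hu⟩⟩

theorem KInv_step {a b : ℕ} (t : ℕ) (ht : 2 ≤ t) (f : Fin a × Fin b → ℕ) (hf : KInv t f) :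
    KInv (t + 1) (BKstep t f) := by
  refine ⟨fun x => ?_, fun u v hc => ?_⟩
  · have := hf.1 x
    rcases BK_cases t ht f hf x with h | ⟨z, h⟩ | ⟨z, h⟩ <;> omega
  · have h1 := hf.1 u
    have h2 := hf.1 v
    have h3 := hf.2 u v hc
    have h4 := BK_swap t f u v hc ht
    rcases BK_cases t ht f hf u with h | ⟨z, h⟩ | ⟨z, h⟩ <;>
    rcases BK_cases t ht f hf v with h' | ⟨z', h'⟩ | ⟨z', h'⟩ <;> grind

theorem sweep_two {a b : ℕ} (f : Fin a × Fin b → ℕ) : sweepUpTo 2 f = f := by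
  simp [sweepUpTo]

theorem sweep_succ {a b : ℕ} (t : ℕ) (ht : 2 ≤ t) (f : Fin a × Fin b → ℕ) :
    sweepUpTo (t + 1) f = BKstep t (sweepUpTo t f) := by
  obtain ⟨k, rfl⟩ := Nat.exists_eq_add_of_le ht
  have h : 2 + k + 1 - 2 = k + 1 := by omega
  have h' : 2 + k - 2 = k := by omega
  simp [sweepUpTo, h, h', List.range'_concat]

theorem KInv_sweep {a b q : ℕ} (V : Fin a × Fin b → ℕ) (hV : IncTab a b q V)
    (t : ℕ) (ht : 2 ≤ t) : KInv t (sweepUpTo t V) := by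
  induction t, ht using Nat.le_induction with
  | base =>
    rw [sweep_two]
    refine ⟨fun x => (hV.1 x).1, fun u v hc => ?_⟩
    have h1 := (hV.1 u).1
    have h : V u < V v := by
      obtain ⟨u1, u2⟩ := u
      obtain ⟨v1, v2⟩ := v
      rcases hc with ⟨h, h'⟩ | ⟨h, h'⟩
      · simp only at h h'; subst h
        exact hV.2.1 _ _ _ (Fin.lt_def.2 (by omega))
      · simp only at h h'; subst h
        exact hV.2.2 _ _ _ (Fin.lt_def.2 (by omega))
    refine ⟨?_, ?_, ?_⟩ <;> intros <;> omega
  | succ t ht ih =>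
    rw [sweep_succ t ht]
    exact KInv_step t ht _ ih

theorem sweep_bound {a b q : ℕ} (V : Fin a × Fin b → ℕ) (hV : IncTab a b q V)
    (m : ℕ) (hm : ∀ x, V x ≤ m) (t : ℕ) (ht : 2 ≤ t) : ∀ x, sweepUpTo t V x ≤ m := by
  induction t, ht using Nat.le_induction with
  | base => rwa [sweep_two]
  | succ t ht ih =>
    intro x
    rw [sweep_succ t ht]
    have h1 := ih x
    rcases BK_cases t ht _ (KInv_sweep V hV t ht) x with h | ⟨z, h⟩ | ⟨z, h⟩
    · omega
    · have := ih z; omega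
    · omega

theorem sweep_noone {a b q : ℕ} (V : Fin a × Fin b → ℕ) (hV : IncTab a b q V)
    (hm : ∀ x, V x ≠ 1) (t : ℕ) (ht : 2 ≤ t) : sweepUpTo t V = V := by
  induction t, ht using Nat.le_induction with
  | base => rw [sweep_two]
  | succ t ht ih =>
    funext x
    rw [sweep_succ t ht]
    have hI := KInv_sweep V hV t ht
    rw [ih] at hI ⊢
    rcases BK_cases t ht _ hI x with h | ⟨z, h⟩ | ⟨z, h⟩
    · exact h
    · exact absurd h.1 (hm x)
    · exact absurd h.2.2 (hm z)

theorem inc_mono {a b q : ℕ} (V : Fin a × Fin b → ℕ) (hV : IncTab a b q V)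
    (i i' : Fin a) (j j' : Fin b) (hi : i ≤ i') (hj : j ≤ j') : V (i, j) ≤ V (i', j') := by
  have h1 : V (i, j) ≤ V (i, j') := by
    rcases hj.eq_or_lt with rfl | h
    · exact le_rfl
    · exact (hV.2.1 _ _ _ h).le
  have h2 : V (i, j') ≤ V (i', j') := by
    rcases hi.eq_or_lt with rfl | h
    · exact le_rfl
    · exact (hV.2.2 _ _ _ h).le
  exact h1.trans h2

/-- Suppose `V ∈ Inc^ℓ(a × b)` satisfies `Frame(V) = Frame(Ψ(V))`. Then
`V(1,1) = 1` and `V(a,b) = ℓ` (corners in 1-based coordinates; here 0-based). -/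
theorem frame_fixed_corners (a b : ℕ) (ha : 0 < a) (hb : 0 < b)
    (ℓ : ℕ) (V : Fin a × Fin b → ℕ) (hV : IncTab a b ℓ V)
    (hframe : FrameEq V (KPro ℓ V)) :
    V (⟨0, ha⟩, ⟨0, hb⟩) = 1 ∧
      V (⟨a - 1, Nat.sub_lt ha Nat.one_pos⟩, ⟨b - 1, Nat.sub_lt hb Nat.one_pos⟩) = ℓ := by
  have hl : 2 ≤ ℓ + 1 := by
    have := hV.1 (⟨0, ha⟩, ⟨0, hb⟩)
    omega
  constructor
  · by_contra hne
    have h0 := (hV.1 (⟨0, ha⟩, ⟨0, hb⟩)).1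
    have hno : ∀ x, V x ≠ 1 := by
      rintro ⟨i, j⟩ hx
      have := inc_mono V hV ⟨0, ha⟩ i ⟨0, hb⟩ j (Fin.le_def.2 (by simp)) (Fin.le_def.2 (by simp))
      omega
    have hf := hframe (⟨0, ha⟩, ⟨0, hb⟩) (Or.inl rfl)
    unfold KPro at hf
    rw [sweep_noone V hV hno _ hl, if_neg hne] at hf
    omega
  · set c : Fin a × Fin b :=
      (⟨a - 1, Nat.sub_lt ha Nat.one_pos⟩, ⟨b - 1, Nat.sub_lt hb Nat.one_pos⟩) with hc
    have hb' : ∀ x, V x ≤ V c := by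
      rintro ⟨i, j⟩
      exact inc_mono V hV i _ j _ (Fin.le_def.2 (by simp; omega)) (Fin.le_def.2 (by simp; omega))
    have h1 := sweep_bound V hV _ hb' (ℓ + 1) hl c
    have h2 := (hV.1 c).1
    have hf := hframe c (Or.inr (Or.inl rfl))
    unfold KPro at hf
    split_ifs at hf with h
    · exact hf
    · omega
end

section
/- Let a, b be positive integers and let T ∈ Inc^q(a × b). Then the result Ψ(T) of applying the K-promotion algorithm to T is again an increasing tableau with all entries positive and at most q; that is, Ψ(T) ∈ Inc^q(a × b). -/
open scoped Classical

/-- `y` is immediately right of, or immediately below, `x`. -/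
def CovBox {a b : ℕ} (x y : Fin a × Fin b) : Prop :=
  (x.1 = y.1 ∧ (x.2 : ℕ) + 1 = (y.2 : ℕ)) ∨ (x.2 = y.2 ∧ (x.1 : ℕ) + 1 = (y.1 : ℕ))

/-- The invariant in force before the step for `t`: reading `1` as `t - 1/2`,
the filling is increasing. -/
def SweepInv {a b : ℕ} (q t : ℕ) (f : Fin a × Fin b → ℕ) : Prop :=
  (∀ x, 1 ≤ f x ∧ f x ≤ q) ∧
  ∀ x y, CovBox x y →
    (if f x = 1 then 2 * t - 1 else 2 * f x) < (if f y = 1 then 2 * t - 1 else 2 * f y)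

lemma BKstep_of_ne {a b : ℕ} (t : ℕ) (f : Fin a × Fin b → ℕ) (x : Fin a × Fin b)
    (h1 : f x ≠ 1) (h2 : f x ≠ t) : BKstep t f x = f x := by
  simp [BKstep, h1, h2]

lemma BKstep_cases {a b : ℕ} (t : ℕ) (f : Fin a × Fin b → ℕ) (x : Fin a × Fin b)
    (h : f x = 1 ∨ f x = t) : BKstep t f x = 1 ∨ BKstep t f x = t := by
  unfold BKstep
  split_ifs <;> simp_all

lemma BKstep_swap {a b : ℕ} (t : ℕ) (f : Fin a × Fin b → ℕ) (x y : Fin a × Fin b)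
    (hc : CovBox x y) (hx : f x = 1) (hy : f y = t) (ht : t ≠ 1) :
    BKstep t f x = t ∧ BKstep t f y = 1 := by
  have hne : y ≠ x := by
    rintro rfl
    exact ht (hy.symm.trans hx)
  have hA : Adj x y := by
    rcases hc with h | h
    · exact Or.inl ⟨h.1, Or.inl h.2⟩
    · exact Or.inr ⟨h.1, Or.inl h.2⟩
  have hA' : Adj y x := by
    rcases hc with h | h
    · exact Or.inl ⟨h.1.symm, Or.inr h.2⟩
    · exact Or.inr ⟨h.1.symm, Or.inr h.2⟩
  have ex : ∃ z, z ≠ x ∧ SameRibbon t f x z :=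
    ⟨y, hne, Relation.ReflTransGen.single ⟨hA, Or.inl hx, Or.inr hy⟩⟩
  have ey : ∃ z, z ≠ y ∧ SameRibbon t f y z :=
    ⟨x, hne.symm, Relation.ReflTransGen.single ⟨hA', Or.inr hy, Or.inl hx⟩⟩
  constructor
  · unfold BKstep
    rw [if_pos ex, if_pos hx]
  · unfold BKstep
    rw [if_pos ey, if_neg (by rw [hy]; exact ht), if_pos hy]

lemma SweepInv.step {a b q t : ℕ} {f : Fin a × Fin b → ℕ} (h2 : 2 ≤ t) (hq : t ≤ q)
    (h : SweepInv q t f) : SweepInv q (t + 1) (BKstep t f) := by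
  obtain ⟨hb, hi⟩ := h
  refine ⟨fun x => ?_, fun x y hc => ?_⟩
  · have := hb x
    by_cases hx : f x = 1 ∨ f x = t
    · rcases BKstep_cases t f x hx with h | h <;> omega
    · rw [BKstep_of_ne t f x (by tauto) (by tauto)]
      exact this
  · have hxy := hi x y hc
    have bx := hb x
    have bY := hb y
    by_cases hs : f x = 1 ∧ f y = t
    · obtain ⟨e1, e2⟩ := BKstep_swap t f x y hc hs.1 hs.2 (by omega)
      rw [e1, e2]
      split_ifs <;> omega
    · have cx : (f x ≠ 1 ∧ f x ≠ t ∧ BKstep t f x = f x) ∨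
          ((f x = 1 ∨ f x = t) ∧ (BKstep t f x = 1 ∨ BKstep t f x = t)) := by
        by_cases hx : f x = 1 ∨ f x = t
        · exact Or.inr ⟨hx, BKstep_cases t f x hx⟩
        · exact Or.inl ⟨by tauto, by tauto, BKstep_of_ne t f x (by tauto) (by tauto)⟩
      have cy : (f y ≠ 1 ∧ f y ≠ t ∧ BKstep t f y = f y) ∨
          ((f y = 1 ∨ f y = t) ∧ (BKstep t f y = 1 ∨ BKstep t f y = t)) := by
        by_cases hx : f y = 1 ∨ f y = t
        · exact Or.inr ⟨hx, BKstep_cases t f y hx⟩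
        · exact Or.inl ⟨by tauto, by tauto, BKstep_of_ne t f y (by tauto) (by tauto)⟩
      generalize BKstep t f x = u at *
      generalize BKstep t f y = v at *
      split_ifs at hxy ⊢ <;> omega

lemma sweep_inv {a b q : ℕ} {T : Fin a × Fin b → ℕ} (h : SweepInv q 2 T) (n : ℕ)
    (hn : n + 1 ≤ q) :
    SweepInv q (n + 2) ((List.range' 2 n).foldl (fun g s => BKstep s g) T) := by
  induction n with
  | zero => simpa using h
  | succ n ih =>
    rw [List.range'_concat, List.foldl_append]
    have := (ih (by omega)).step (by omega) (by omega)
    simpa [add_comm, add_left_comm, add_assoc] using this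

lemma lt_of_adjacent {n : ℕ} (g : Fin n → ℕ)
    (h : ∀ i j : Fin n, (i : ℕ) + 1 = j → g i < g j) (i j : Fin n) (hij : i < j) :
    g i < g j := by
  cases n with
  | zero => exact i.elim0
  | succ n =>
    exact Fin.strictMono_iff_lt_succ.2 (fun k => h _ _ (by simp)) hij

/-- Let `T ∈ Inc^q(a × b)`. Then the result `Ψ(T)` of the K-promotion algorithm
is again an increasing tableau with positive entries at most `q`; that is,
`Ψ(T) ∈ Inc^q(a × b)`. -/
theorem kpromotion_mem_incTab (a b : ℕ) (ha : 0 < a) (hb : 0 < b)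
    (q : ℕ) (T : Fin a × Fin b → ℕ) (hT : IncTab a b q T) :
    IncTab a b q (KPro q T) := by
  have hq : 1 ≤ q := by
    have := hT.1 (⟨0, ha⟩, ⟨0, hb⟩)
    omega
  have h0 : SweepInv q 2 T := by
    refine ⟨hT.1, fun x y hc => ?_⟩
    have bx := hT.1 x
    have bY := hT.1 y
    have hlt : T x < T y := by
      obtain ⟨x1, x2⟩ := x
      obtain ⟨y1, y2⟩ := y
      rcases hc with ⟨e, h⟩ | ⟨e, h⟩
      · simp only at e h
        subst e
        exact hT.2.1 _ _ _ (by rw [Fin.lt_def]; omega)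
      · simp only at e h
        subst e
        exact hT.2.2 _ _ _ (by rw [Fin.lt_def]; omega)
    split_ifs <;> omega
  have h1 : SweepInv q (q + 1) (sweepUpTo (q + 1) T) := by
    have := sweep_inv h0 (q - 1) (by omega)
    have e : q - 1 + 2 = q + 1 := by omega
    have e' : q + 1 - 2 = q - 1 := by omega
    rw [e] at this
    unfold sweepUpTo
    rw [e']
    exact this
  have hcov : ∀ x y, CovBox x y → KPro q T x < KPro q T y := by
    intro x y hc
    have := h1.2 x y hc
    have bx := h1.1 x
    have bY := h1.1 y
    unfold KPro
    split_ifs at this ⊢ <;> omega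
  refine ⟨fun x => ?_, fun i => ?_, fun i₁ i₂ j => ?_⟩
  · have bx := h1.1 x
    unfold KPro
    split_ifs <;> omega
  · exact lt_of_adjacent (fun j => KPro q T (i, j))
      (fun j₁ j₂ h => hcov _ _ (Or.inl ⟨rfl, h⟩))
  · exact lt_of_adjacent (fun i => KPro q T (i, j))
      (fun j₁ j₂ h => hcov _ _ (Or.inr ⟨rfl, h⟩)) i₁ i₂
end

section
/- Let a, b be positive integers, let q ≥ a+b−1, and let T ∈ Inc^q(a × b). Suppose the K-promotion orbit of T has cardinality k with gcd(k, q) = 1. Then Frame(U) = Frame(T) for every tableau U in the Ψ-orbit of T; in particular, Frame(T) = Frame(Ψ(T)). -/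
open scoped Classical

/-! ### Abstract growth families -/

structure FamW (a b : ℕ) (q : ℤ) (A : ℤ → ℕ → ℕ → ℤ) : Prop where
  row : ∀ i r c₁ c₂, r < a → c₁ < c₂ → c₂ < b → A i r c₁ < A i r c₂
  col : ∀ i r₁ r₂ c, r₁ < r₂ → r₂ < a → c < b → A i r₁ c < A i r₂ c
  lo : ∀ i r c, r < a → c < b → i < A i r c
  hi : ∀ i r c, r < a → c < b → A i r c ≤ i + q
  nc : ∀ i r₁ r₂ c, r₁ < r₂ → r₂ < a → c < b → A (i + 1) r₁ c ≤ A i r₂ c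
  d : ∀ i r c, r < a → c < b → A i r c ≠ i + 1 →
    A (i + 1) r c = A i r c ∨ (∃ c₀, c₀ + 1 = c ∧ A (i + 1) r c₀ = A i r c) ∨
      (∃ r₀, r₀ + 1 = r ∧ A (i + 1) r₀ c = A i r c)

structure Fam (a b : ℕ) (q : ℤ) (A : ℤ → ℕ → ℕ → ℤ) : Prop extends FamW a b q A where
  mono : ∀ i r c, r < a → c < b → A i r c ≤ A (i + 1) r c
  nr : ∀ i r c₁ c₂, r < a → c₁ < c₂ → c₂ < b → A (i + 1) r c₁ ≤ A i r c₂
  d' : ∀ i r c, r < a → c < b → A (i + 1) r c ≠ i + 1 + q →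
    A i r c = A (i + 1) r c ∨ (c + 1 < b ∧ A i r (c + 1) = A (i + 1) r c) ∨
      (r + 1 < a ∧ A i (r + 1) c = A (i + 1) r c)

inductive Ch (a b : ℕ) (S : ℕ → ℕ → ℤ) (lo : ℤ) : ℕ → ℕ → ℕ → Prop
  | one (r c : ℕ) : r < a → c < b → lo < S r c → Ch a b S lo 1 r c
  | step (m r c r' c' : ℕ) : Ch a b S lo m r c → r' ≤ r → c < c' → c' < b →
      S r c < S r' c' → Ch a b S lo (m + 1) r' c'

theorem Ch.basic {a b : ℕ} {S : ℕ → ℕ → ℤ} {lo : ℤ} {m r c : ℕ} (h : Ch a b S lo m r c) :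
    r < a ∧ c < b ∧ lo < S r c ∧ m ≤ c + 1 := by
  induction h with
  | one r c h1 h2 h3 => exact ⟨h1, h2, h3, by omega⟩
  | step m r c r' c' h h1 h2 h3 h4 ih => obtain ⟨h5, h6, h7, h8⟩ := ih; refine ⟨?_, ?_, ?_, ?_⟩ <;> omega

theorem FamW.slide {a b : ℕ} {q : ℤ} {A : ℤ → ℕ → ℕ → ℤ} (F : FamW a b q A) (i lo : ℤ)
    (hlo : i + 1 ≤ lo) {m r c : ℕ} (h : Ch a b (A i) lo m r c) :
    ∃ r' c', Ch a b (A (i + 1)) lo m r' c' ∧ c' ≤ c ∧ A (i + 1) r' c' ≤ A i r c := by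
  induction h with
  | one r c h1 h2 h3 =>
    rcases F.d i r c h1 h2 (by omega) with h | ⟨c₀, hc, h⟩ | ⟨r₀, hr, h⟩
    · exact ⟨r, c, .one _ _ h1 h2 (by omega), le_rfl, h.le⟩
    · exact ⟨r, c₀, .one _ _ h1 (by omega) (by omega), by omega, h.le⟩
    · exact ⟨r₀, c, .one _ _ (by omega) h2 (by omega), le_rfl, h.le⟩
  | step m r c r2 c2 h h1 h2 h3 h4 ih =>
    obtain ⟨r', c', hch, hc', hv⟩ := ih
    obtain ⟨hra, hcb, hl, -⟩ := h.basic
    obtain ⟨hra', hcb', hl', -⟩ := hch.basic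
    by_cases hr : r' < r2
    · exact ⟨r', c2, .step _ _ _ _ _ hch le_rfl (by omega) h3
        (F.row _ _ _ _ hra' (by omega) h3), le_rfl, F.nc _ _ _ _ hr (by omega) h3⟩
    · push Not at hr
      rcases F.d i r2 c2 (by omega) h3 (by omega) with h | ⟨c₀, hc, h⟩ | ⟨r₀, hr, h⟩
      · exact ⟨r2, c2, .step _ _ _ _ _ hch hr (by omega) h3 (by omega), le_rfl, h.le⟩
      · have : c' ≠ c₀ := by
          rintro rfl
          rcases hr.eq_or_lt with rfl | hr
          · omega
          · have := F.col (i + 1) _ _ _ hr hra' hcb'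
            omega
        exact ⟨r2, c₀, .step _ _ _ _ _ hch hr (by omega) (by omega) (by omega), by omega, h.le⟩
      · exact ⟨r₀, c2, .step _ _ _ _ _ hch (by omega) (by omega) h3 (by omega), le_rfl, h.le⟩

theorem FamW.slides {a b : ℕ} {q : ℤ} {A : ℤ → ℕ → ℕ → ℤ} (F : FamW a b q A) (s lo : ℤ)
    (t : ℕ) (hlo : s + t ≤ lo) {m r c : ℕ} (h : Ch a b (A s) lo m r c) :
    ∃ r' c', Ch a b (A (s + t)) lo m r' c' ∧ A (s + t) r' c' ≤ A s r c := by
  induction t with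
  | zero => exact ⟨r, c, by simpa using h, by simp⟩
  | succ t ih =>
    push_cast at hlo ⊢
    obtain ⟨r', c', h1, h2⟩ := ih (by omega)
    obtain ⟨r2, c2, h3, -, h4⟩ := F.slide (s + t) lo (by omega) h1
    rw [← add_assoc]
    exact ⟨r2, c2, h3, by omega⟩

theorem FamW.rowChain {a b : ℕ} {q : ℤ} {A : ℤ → ℕ → ℕ → ℤ} (F : FamW a b q A) (s lo : ℤ)
    (r c : ℕ) (hr : r < a) (n : ℕ) (hc : c + n < b) (h : lo < A s r c) :
    Ch a b (A s) lo (n + 1) r (c + n) := by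
  induction n with
  | zero => exact .one _ _ hr hc h
  | succ n ih =>
    exact .step _ _ _ _ _ (ih (by omega)) le_rfl (by omega) hc
      (F.row _ _ _ _ hr (by omega) hc)

theorem FamW.lemA {a b : ℕ} {q : ℤ} {A : ℤ → ℕ → ℕ → ℤ} (F : FamW a b q A) (ha : 0 < a)
    (s : ℤ) (t c : ℕ) (hc : c < b) (h : s + t < A s (a - 1) c) :
    A (s + t) 0 (b - 1 - c) ≤ s + q := by
  have h1 := F.rowChain s (s + t) (a - 1) c (by omega) (b - 1 - c) (by omega) h
  obtain ⟨r', c', h2, h3⟩ := F.slides s (s + t) t le_rfl h1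
  obtain ⟨h4, h5, h6, h7⟩ := h2.basic
  have h8 := F.hi s (a - 1) (c + (b - 1 - c)) (by omega) (by omega)
  have h9 : A (s + t) 0 (b - 1 - c) ≤ A (s + t) 0 c' := by
    rcases (show b - 1 - c ≤ c' by omega).eq_or_lt with e | e
    · rw [e]
    · exact (F.row _ _ _ _ ha e h5).le
  have h10 : A (s + t) 0 c' ≤ A (s + t) r' c' := by
    rcases (Nat.zero_le r').eq_or_lt with e | e
    · rw [e]
    · exact (F.col _ _ _ _ e h4 h5).le
  omega

theorem Fam.mono_le {a b : ℕ} {q : ℤ} {A : ℤ → ℕ → ℕ → ℤ} (F : Fam a b q A) {i j : ℤ}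
    (hij : i ≤ j) {r c : ℕ} (hr : r < a) (hc : c < b) : A i r c ≤ A j r c := by
  induction j, hij using Int.leInduction with
  | base => exact le_rfl
  | succ n hn ih => exact ih.trans (F.mono _ _ _ hr hc)

theorem Fam.existsD {a b : ℕ} {q : ℤ} {A : ℤ → ℕ → ℕ → ℤ} (F : Fam a b q A) :
    ∃ D : ℤ → ℕ → ℕ → ℤ, ∀ j r c, r < a → c < b → ∀ i, D j r c ≤ i ↔ j < A i r c := by
  have : ∀ j r c, ∃ d : ℤ, r < a → c < b → ∀ i, d ≤ i ↔ j < A i r c := by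
    intro j r c
    by_cases h : r < a ∧ c < b
    · obtain ⟨hr, hc⟩ := h
      obtain ⟨d, hd, hd2⟩ := Int.exists_least_of_bdd (P := fun i => j < A i r c)
        ⟨j - q, fun z hz => by have := F.hi z r c hr hc; omega⟩ ⟨j, F.lo j r c hr hc⟩
      exact ⟨d, fun _ _ i => ⟨fun h => lt_of_lt_of_le hd (F.mono_le h hr hc), fun h => hd2 i h⟩⟩
    · exact ⟨0, fun h1 h2 => absurd ⟨h1, h2⟩ h⟩
  choose D hD using this
  exact ⟨D, hD⟩

theorem Fam.famG {a b : ℕ} {q : ℤ} {A : ℤ → ℕ → ℕ → ℤ} (F : Fam a b q A)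
    {D : ℤ → ℕ → ℕ → ℤ} (hD : ∀ j r c, r < a → c < b → ∀ i, D j r c ≤ i ↔ j < A i r c) :
    FamW a b q (fun i r c => q + D i (a - 1 - r) (b - 1 - c)) where
  row i r c₁ c₂ hr h1 h2 := by
    have e := (hD i (a - 1 - r) (b - 1 - c₂) (by omega) (by omega) _).1 le_rfl
    have := (hD i (a - 1 - r) (b - 1 - c₁) (by omega) (by omega)
      (D i (a - 1 - r) (b - 1 - c₂) - 1)).2 (by
        have := F.nr (D i (a - 1 - r) (b - 1 - c₂) - 1) (a - 1 - r) (b - 1 - c₂) (b - 1 - c₁)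
          (by omega) (by omega) (by omega)
        simp only [sub_add_cancel] at this
        omega)
    omega
  col i r₁ r₂ c h1 h2 hc := by
    have e := (hD i (a - 1 - r₂) (b - 1 - c) (by omega) (by omega) _).1 le_rfl
    have := (hD i (a - 1 - r₁) (b - 1 - c) (by omega) (by omega)
      (D i (a - 1 - r₂) (b - 1 - c) - 1)).2 (by
        have := F.nc (D i (a - 1 - r₂) (b - 1 - c) - 1) (a - 1 - r₂) (a - 1 - r₁) (b - 1 - c)
          (by omega) (by omega) (by omega)
        simp only [sub_add_cancel] at this
        omega)
    omega
  lo i r c hr hc := by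
    have := F.hi (i - q) (a - 1 - r) (b - 1 - c) (by omega) (by omega)
    have e := hD i (a - 1 - r) (b - 1 - c) (by omega) (by omega) (i - q)
    by_contra hh
    have := e.1 (by omega)
    omega
  hi i r c hr hc := by
    have := (hD i (a - 1 - r) (b - 1 - c) (by omega) (by omega) i).2
      (F.lo _ _ _ (by omega) (by omega))
    omega
  nc i r₁ r₂ c h1 h2 hc := by
    have e := (hD i (a - 1 - r₂) (b - 1 - c) (by omega) (by omega) _).1 le_rfl
    have := (hD (i + 1) (a - 1 - r₁) (b - 1 - c) (by omega) (by omega)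
      (D i (a - 1 - r₂) (b - 1 - c))).2 (by
        have := F.col (D i (a - 1 - r₂) (b - 1 - c)) (a - 1 - r₂) (a - 1 - r₁) (b - 1 - c)
          (by omega) (by omega) (by omega)
        omega)
    omega
  d i r c hr hc hne := by
    have hR : a - 1 - r < a := by omega
    have hC : b - 1 - c < b := by omega
    generalize hRe : a - 1 - r = R at *
    generalize hCe : b - 1 - c = C at *
    obtain ⟨u, hu⟩ : ∃ u, u = D i R C := ⟨_, rfl⟩
    rw [← hu] at hne ⊢
    have e1 := (hD i R C hR hC u).1 hu.ge
    have e2 : A (u - 1) R C ≤ i := by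
      by_contra hh
      have := (hD i R C hR hC (u - 1)).2 (by omega)
      omega
    have key : ∀ R' C', R' < a → C' < b → i + 1 < A u R' C' → A (u - 1) R' C' ≤ i + 1 →
        q + D (i + 1) R' C' = q + u := by
      intro R' C' h1 h2 h3 h4
      have f1 := (hD (i + 1) R' C' h1 h2 u).2 h3
      have f2 := (hD (i + 1) R' C' h1 h2 (u - 1)).not.2 (by omega)
      omega
    by_cases hA : i + 1 < A u R C
    · exact .inl (key R C hR hC hA (by omega))
    · have h3 : A u R C = i + 1 := by omega
      have h4 := F.d' (u - 1) R C hR hC (by simp only [sub_add_cancel]; omega)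
      simp only [sub_add_cancel] at h4
      rcases h4 with h4 | ⟨h5, h4⟩ | ⟨h5, h4⟩
      · omega
      · refine .inr (.inl ⟨c - 1, by omega, ?_⟩)
        rw [show b - 1 - (c - 1) = C + 1 by omega]
        have := F.row u R C (C + 1) hR (by omega) h5
        exact key R (C + 1) hR h5 (by omega) (by omega)
      · refine .inr (.inr ⟨r - 1, by omega, ?_⟩)
        rw [show a - 1 - (r - 1) = R + 1 by omega]
        have := F.col u R (R + 1) C (by omega) h5 hC
        exact key (R + 1) C h5 hC (by omega) (by omega)

theorem Fam.first_row {a b : ℕ} {q : ℤ} {A : ℤ → ℕ → ℕ → ℤ} (F : Fam a b q A) (ha : 0 < a)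
    (u : ℤ) (c : ℕ) (hc : c < b) : A (u + q) 0 c ≤ A u 0 c + q := by
  obtain ⟨D, hD⟩ := F.existsD
  have G := F.famG hD
  obtain ⟨s, hs⟩ : ∃ s, s = A u 0 c := ⟨_, rfl⟩
  have h1 := F.lo u 0 c ha hc
  have h2 := F.hi u 0 c ha hc
  obtain ⟨t, ht⟩ : ∃ t : ℕ, (t : ℤ) = u + q - s := ⟨(u + q - s).toNat, by omega⟩
  have h3 := G.lemA ha s t (b - 1 - c) (by omega) (by
    have := (hD s 0 c ha hc (s + t - q)).not.2 (by
      rw [show s + t - q = u by omega]; omega)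
    simp only [show a - 1 - (a - 1) = 0 by omega, show b - 1 - (b - 1 - c) = c by omega]
    omega)
  simp only [show b - 1 - (b - 1 - c) = c by omega, Nat.sub_zero] at h3
  have h4 := (hD (s + t) (a - 1) (b - 1 - c) (by omega) (by omega) s).1 (by omega)
  have h5 := F.lemA ha s t (b - 1 - c) (by omega) h4
  simp only [show b - 1 - (b - 1 - c) = c by omega] at h5
  rw [show s + t = u + q by omega] at h5
  omega

theorem Fam.rev {a b : ℕ} {q : ℤ} {A : ℤ → ℕ → ℕ → ℤ} (F : Fam a b q A) :
    Fam a b q (fun i r c => q + 1 - A (-i) (a - 1 - r) (b - 1 - c)) where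
  row i r c₁ c₂ hr h1 h2 := by
    have := F.row (-i) (a - 1 - r) (b - 1 - c₂) (b - 1 - c₁) (by omega) (by omega) (by omega)
    omega
  col i r₁ r₂ c h1 h2 hc := by
    have := F.col (-i) (a - 1 - r₂) (a - 1 - r₁) (b - 1 - c) (by omega) (by omega) (by omega)
    omega
  lo i r c hr hc := by
    have := F.hi (-i) (a - 1 - r) (b - 1 - c) (by omega) (by omega)
    omega
  hi i r c hr hc := by
    have := F.lo (-i) (a - 1 - r) (b - 1 - c) (by omega) (by omega)
    omega
  nc i r₁ r₂ c h1 h2 hc := by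
    have := F.nc (-(i + 1)) (a - 1 - r₂) (a - 1 - r₁) (b - 1 - c) (by omega) (by omega) (by omega)
    rw [show -(i + 1) + 1 = -i by ring] at this
    omega
  nr i r c₁ c₂ hr h1 h2 := by
    have := F.nr (-(i + 1)) (a - 1 - r) (b - 1 - c₂) (b - 1 - c₁) (by omega) (by omega) (by omega)
    rw [show -(i + 1) + 1 = -i by ring] at this
    omega
  mono i r c hr hc := by
    have := F.mono (-(i + 1)) (a - 1 - r) (b - 1 - c) (by omega) (by omega)
    rw [show -(i + 1) + 1 = -i by ring] at this
    omega
  d i r c hr hc hne := by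
    have := F.d' (-(i + 1)) (a - 1 - r) (b - 1 - c) (by omega) (by omega)
    rw [show -(i + 1) + 1 = -i by ring] at this
    rcases this (by omega) with h | ⟨h1, h⟩ | ⟨h1, h⟩
    · left; omega
    · refine .inr (.inl ⟨c - 1, by omega, ?_⟩)
      rw [show b - 1 - (c - 1) = b - 1 - c + 1 by omega]; omega
    · refine .inr (.inr ⟨r - 1, by omega, ?_⟩)
      rw [show a - 1 - (r - 1) = a - 1 - r + 1 by omega]; omega
  d' i r c hr hc hne := by
    have := F.d (-(i + 1)) (a - 1 - r) (b - 1 - c) (by omega) (by omega)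
    rw [show -(i + 1) + 1 = -i by ring] at this
    rcases this (by omega) with h | ⟨c₀, h1, h⟩ | ⟨r₀, h1, h⟩
    · left; omega
    · refine .inr (.inl ⟨by omega, ?_⟩)
      rw [show b - 1 - (c + 1) = c₀ by omega]; omega
    · refine .inr (.inr ⟨by omega, ?_⟩)
      rw [show a - 1 - (r + 1) = r₀ by omega]; omega

theorem Fam.transp {a b : ℕ} {q : ℤ} {A : ℤ → ℕ → ℕ → ℤ} (F : Fam a b q A) :
    Fam b a q (fun i r c => A i c r) where
  row i r c₁ c₂ hr h1 h2 := F.col _ _ _ _ h1 h2 hr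
  col i r₁ r₂ c h1 h2 hc := F.row _ _ _ _ hc h1 h2
  lo i r c hr hc := F.lo _ _ _ hc hr
  hi i r c hr hc := F.hi _ _ _ hc hr
  nc i r₁ r₂ c h1 h2 hc := F.nr _ _ _ _ hc h1 h2
  nr i r c₁ c₂ hr h1 h2 := F.nc _ _ _ _ h1 h2 hr
  mono i r c hr hc := F.mono _ _ _ hc hr
  d i r c hr hc hne := by
    rcases F.d i c r hc hr hne with h | h | h
    exacts [.inl h, .inr (.inr h), .inr (.inl h)]
  d' i r c hr hc hne := by
    rcases F.d' i c r hc hr hne with h | h | h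
    exacts [.inl h, .inr (.inr h), .inr (.inl h)]

theorem Fam.last_row {a b : ℕ} {q : ℤ} {A : ℤ → ℕ → ℕ → ℤ} (F : Fam a b q A) (ha : 0 < a)
    (u : ℤ) (c : ℕ) (hc : c < b) : A (u + q) (a - 1) c ≤ A u (a - 1) c + q := by
  have := F.rev.first_row ha (-(u + q)) (b - 1 - c) (by omega)
  simp only [show -(-(u + q) + q) = u by ring, neg_neg, Nat.sub_zero,
    show b - 1 - (b - 1 - c) = c by omega] at this
  omega

/-! ### The concrete sweep -/

theorem Adj.ne' {a b : ℕ} {x y : Fin a × Fin b} (h : Adj x y) : y ≠ x := by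
  rintro rfl
  unfold Adj at h
  omega

theorem Adj.symm' {a b : ℕ} {x y : Fin a × Fin b} (h : Adj x y) : Adj y x := by
  unfold Adj at *
  rcases h with ⟨h1, h2⟩ | ⟨h1, h2⟩
  · exact .inl ⟨h1.symm, h2.symm⟩
  · exact .inr ⟨h1.symm, h2.symm⟩

theorem adj_iff_s16 {a b : ℕ} {x y : Fin a × Fin b} : Adj x y ↔ Nx x y ∨ Nx y x := by
  unfold Adj Nx
  rw [eq_comm (a := y.1), eq_comm (a := y.2)]
  tauto

def Act {a b : ℕ} (t : ℕ) (f : Fin a × Fin b → ℕ) (x : Fin a × Fin b) : Prop :=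
  ∃ z, Adj x z ∧ (f x = 1 ∨ f x = t) ∧ (f z = 1 ∨ f z = t)

theorem act_iff {a b : ℕ} (t : ℕ) (f : Fin a × Fin b → ℕ) (x : Fin a × Fin b) :
    (∃ y, y ≠ x ∧ SameRibbon t f x y) ↔ Act t f x := by
  constructor
  · rintro ⟨y, hy, h⟩
    rcases Relation.ReflTransGen.cases_head h with h | ⟨z, h, -⟩
    · exact absurd h.symm hy
    · exact ⟨z, h⟩
  · rintro ⟨z, h⟩
    exact ⟨z, h.1.ne', Relation.ReflTransGen.single h⟩

theorem bk_act {a b : ℕ} {t : ℕ} {f : Fin a × Fin b → ℕ} {x : Fin a × Fin b}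
    (h : Act t f x) :
    (f x = 1 ∧ BKstep t f x = t) ∨ (f x = t ∧ BKstep t f x = 1) := by
  unfold BKstep
  rw [if_pos ((act_iff t f x).2 h)]
  obtain ⟨z, -, h1 | h1, -⟩ := h
  · simp [h1]
  · by_cases h2 : t = 1
    · subst h2; simp [h1]
    · simp [h1, h2]

theorem bk_nact {a b : ℕ} {t : ℕ} {f : Fin a × Fin b → ℕ} {x : Fin a × Fin b}
    (h : ¬ Act t f x) : BKstep t f x = f x := by
  unfold BKstep
  rw [if_neg (fun h' => h ((act_iff t f x).1 h'))]

theorem bk_mem {a b : ℕ} (t : ℕ) (f : Fin a × Fin b → ℕ) (x : Fin a × Fin b) :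
    (BKstep t f x = 1 ∨ BKstep t f x = t) ↔ (f x = 1 ∨ f x = t) := by
  by_cases h : Act t f x
  · rcases bk_act h with ⟨h1, h2⟩ | ⟨h1, h2⟩ <;> simp [h1, h2]
  · rw [bk_nact h]

theorem bk_invol {a b : ℕ} (t : ℕ) (f : Fin a × Fin b → ℕ) :
    BKstep t (BKstep t f) = f := by
  funext x
  have key : Act t (BKstep t f) x ↔ Act t f x := by
    unfold Act
    simp only [bk_mem]
  by_cases h : Act t f x
  · have h1 := bk_act h
    have h2 := bk_act (key.2 h)
    omega
  · rw [bk_nact (fun h' => h (key.1 h')), bk_nact h]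

theorem sweep_inj {a b : ℕ} (t : ℕ) (ht : 2 ≤ t) {f g : Fin a × Fin b → ℕ}
    (h : sweepUpTo t f = sweepUpTo t g) : f = g := by
  induction t, ht using Nat.le_induction with
  | base => exact h
  | succ t ht ih =>
    rw [sweep_succ t ht, sweep_succ t ht] at h
    apply ih
    rw [← bk_invol t (sweepUpTo t f), h, bk_invol]

structure SwInv {a b : ℕ} (q : ℕ) (T : Fin a × Fin b → ℕ) (t : ℕ) (f : Fin a × Fin b → ℕ) :
    Prop where
  rng : ∀ x, 1 ≤ f x ∧ f x ≤ q
  inc : ∀ x y, Nx x y → f y ≠ 1 → f x < f y ∧ (f x = 1 → t ≤ f y)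
  inc1 : ∀ x y, Nx x y → f y = 1 → f x ≠ 1 ∧ f x < t
  old : ∀ x, t ≤ T x → f x = T x
  old' : ∀ x, t ≤ f x → f x = T x
  ge : ∀ x, f x = 1 ∨ T x ≤ f x
  le : ∀ x y, Nx x y → f x ≠ 1 → f x ≤ T y
  d : ∀ x, T x ≠ 1 → f x = T x ∨ ∃ y, Nx y x ∧ f y = T x
  d' : ∀ x, f x ≠ 1 → T x = f x ∨ ∃ y, Nx x y ∧ T y = f x

theorem IncTab.nx {a b q : ℕ} {T : Fin a × Fin b → ℕ} (hT : IncTab a b q T)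
    {x y : Fin a × Fin b} (h : Nx x y) : T x < T y := by
  obtain ⟨x1, x2⟩ := x
  obtain ⟨y1, y2⟩ := y
  rcases h with ⟨h1, h2⟩ | ⟨h1, h2⟩
  · dsimp only at h1 h2
    subst h1
    exact hT.2.1 _ _ _ (by rw [Fin.lt_def]; omega)
  · dsimp only at h1 h2
    subst h1
    exact hT.2.2 _ _ _ (by rw [Fin.lt_def]; omega)

theorem inv_two {a b q : ℕ} {T : Fin a × Fin b → ℕ} (hT : IncTab a b q T) : SwInv q T 2 T where
  rng := hT.1
  inc x y h hy := by
    have := hT.nx h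
    have := hT.1 y
    have := hT.1 x
    omega
  inc1 x y h hy := by
    have := hT.nx h
    have := hT.1 x
    omega
  old x h := rfl
  old' x h := rfl
  ge x := .inr le_rfl
  le x y h _ := (hT.nx h).le
  d x h := .inl rfl
  d' x h := .inl rfl

theorem inv_succ {a b q : ℕ} {T : Fin a × Fin b → ℕ} {t : ℕ} (ht : 2 ≤ t) (htq : t ≤ q)
    {f : Fin a × Fin b → ℕ} (I : SwInv q T t f) : SwInv q T (t + 1) (BKstep t f) := by
  -- trichotomy
  have tri : ∀ x, (f x = 1 ∧ BKstep t f x = t) ∨ (f x = t ∧ BKstep t f x = 1) ∨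
      BKstep t f x = f x := by
    intro x
    by_cases h : Act t f x
    · rcases bk_act h with h | h
      · exact .inl h
      · exact .inr (.inl h)
    · exact .inr (.inr (bk_nact h))
  have act1 : ∀ x y, Nx x y → f x = 1 → f y = t → BKstep t f x = t ∧ BKstep t f y = 1 := by
    intro x y h hx hy
    have hxy : Adj x y := adj_iff_s16.2 (.inl h)
    have h1 := bk_act (t := t) (f := f) (x := x) ⟨y, hxy, .inl hx, .inr hy⟩
    have h2 := bk_act (t := t) (f := f) (x := y) ⟨x, hxy.symm', .inr hy, .inl hx⟩
    omega
  -- a moved box has a partner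
  have part1 : ∀ x, f x = 1 → BKstep t f x = t → ∃ y, Nx x y ∧ f y = t := by
    intro x hx hg
    by_cases h : Act t f x
    · obtain ⟨z, hz, -, hfz⟩ := h
      rcases adj_iff_s16.1 hz with h | h
      · refine ⟨z, h, ?_⟩
        rcases hfz with h1 | h1
        · have := I.inc1 _ _ h h1; omega
        · exact h1
      · have := I.inc1 _ _ h hx
        omega
    · rw [bk_nact h] at hg; omega
  have part2 : ∀ x, f x = t → BKstep t f x = 1 → ∃ y, Nx y x ∧ f y = 1 := by
    intro x hx hg
    by_cases h : Act t f x
    · obtain ⟨z, hz, -, hfz⟩ := h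
      rcases adj_iff_s16.1 hz with h | h
      · rcases hfz with h1 | h1
        · have := I.inc1 _ _ h h1; omega
        · have := I.inc _ _ h (by omega); omega
      · refine ⟨z, h, ?_⟩
        rcases hfz with h1 | h1
        · exact h1
        · have := I.inc _ _ h (by omega); omega
    · rw [bk_nact h] at hg; omega
  refine ⟨?_, ?_, ?_, ?_, ?_, ?_, ?_, ?_, ?_⟩
  · intro x
    have := tri x
    have := I.rng x
    omega
  · intro x y h hy
    have h1 := tri x
    have h2 := tri y
    have h3 := I.inc x y h
    have h4 := I.inc1 x y h
    have h5 := act1 x y h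
    have := I.rng x
    have := I.rng y
    omega
  · intro x y h hy
    have h1 := tri x
    have h2 := tri y
    have h3 := I.inc x y h
    have h4 := I.inc1 x y h
    have h5 := act1 x y h
    have := I.rng x
    have := I.rng y
    omega
  · intro x h
    have h1 := tri x
    have h2 := I.old x
    omega
  · intro x h
    have h1 := tri x
    have h2 := I.old' x
    omega
  · intro x
    have h1 := tri x
    have h2 := I.old x
    have h3 := I.ge x
    omega
  · intro x y h hx
    have h1 := tri x
    have h2 := I.le x y h
    have h3 := I.inc x y h
    have h4 := I.inc1 x y h
    have h5 := I.old' y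
    omega
  · intro x hx
    by_cases hv : T x = t
    · have h1 := I.old x hv.ge
      rcases tri x with h | h | h
      · omega
      · obtain ⟨y, hy, hy1⟩ := part2 x h.1 h.2
        exact .inr ⟨y, hy, by rw [(act1 y x hy hy1 (by omega)).1, hv]⟩
      · exact .inl (by omega)
    · rcases I.d x hx with h | ⟨y, hy, h⟩
      · have := tri x
        exact .inl (by omega)
      · have := tri y
        exact .inr ⟨y, hy, by omega⟩
  · intro x hx
    rcases tri x with h | h | h
    · obtain ⟨y, hy, hy1⟩ := part1 x h.1 h.2
      have := I.old' y
      exact .inr ⟨y, hy, by omega⟩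
    · omega
    · rw [h] at hx ⊢
      exact I.d' x hx

theorem inv_final {a b q : ℕ} {T : Fin a × Fin b → ℕ} (hT : IncTab a b q T) (hq : 1 ≤ q) :
    SwInv q T (q + 1) (sweepUpTo (q + 1) T) := by
  have : ∀ t, 2 ≤ t → t ≤ q + 1 → SwInv q T t (sweepUpTo t T) := by
    intro t ht
    induction t, ht using Nat.le_induction with
    | base => intro _; exact inv_two hT
    | succ t ht ih =>
      intro h
      rw [sweep_succ t ht]
      exact inv_succ ht (by omega) (ih (by omega))
  exact this (q + 1) (by omega) le_rfl

/-- Properties of one K-promotion step. -/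
structure Pro {a b : ℕ} (q : ℕ) (T U : Fin a × Fin b → ℕ) : Prop where
  rng : ∀ x, 1 ≤ U x ∧ U x ≤ q
  inc : ∀ x y, Nx x y → U x < U y
  ge : ∀ x, T x ≤ U x + 1
  le : ∀ x y, Nx x y → U x + 1 ≤ T y
  d : ∀ x, T x ≠ 1 → U x + 1 = T x ∨ ∃ y, Nx y x ∧ U y + 1 = T x
  d' : ∀ x, U x ≠ q → T x = U x + 1 ∨ ∃ y, Nx x y ∧ T y = U x + 1

theorem kpro_pro {a b q : ℕ} {T : Fin a × Fin b → ℕ} (hT : IncTab a b q T) (hq : 1 ≤ q) :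
    Pro q T (KPro q T) := by
  have I := inv_final hT hq
  have hK : ∀ x, (sweepUpTo (q + 1) T x = 1 ∧ KPro q T x = q) ∨
      (sweepUpTo (q + 1) T x ≠ 1 ∧ KPro q T x = sweepUpTo (q + 1) T x - 1) := by
    intro x
    unfold KPro
    split_ifs with h
    · exact .inl ⟨h, rfl⟩
    · exact .inr ⟨h, rfl⟩
  generalize sweepUpTo (q + 1) T = f at I hK
  generalize KPro q T = U at hK
  refine ⟨?_, ?_, ?_, ?_, ?_, ?_⟩
  · intro x
    have := hK x
    have := I.rng x
    omega
  · intro x y h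
    have := hK x
    have := hK y
    have := I.rng x
    have := I.rng y
    have := I.inc x y h
    have := I.inc1 x y h
    omega
  · intro x
    have := hK x
    have := I.rng x
    have := I.ge x
    have := hT.1 x
    omega
  · intro x y h
    have := hK x
    have := I.rng x
    have := I.rng y
    have := I.le x y h
    have := I.inc x y h
    have := I.inc1 x y h
    omega
  · intro x hx
    have := hT.1 x
    rcases I.d x hx with h | ⟨y, hy, h⟩
    · have := hK x
      exact .inl (by omega)
    · have := hK y
      exact .inr ⟨y, hy, by omega⟩
  · intro x hx
    have := hK x
    have := I.rng x
    have e : f x = U x + 1 := by omega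
    rw [← e]
    exact I.d' x (by omega)

theorem incTab_of_nx {a b q : ℕ} {U : Fin a × Fin b → ℕ} (hr : ∀ x, 1 ≤ U x ∧ U x ≤ q)
    (hi : ∀ x y, Nx x y → U x < U y) : IncTab a b q U := by
  refine ⟨hr, ?_, ?_⟩
  · intro i j₁ j₂ h
    obtain ⟨j₁, h1⟩ := j₁
    obtain ⟨j₂, h2⟩ := j₂
    rw [Fin.mk_lt_mk] at h
    induction j₂, h using Nat.le_induction with
    | base => exact hi _ _ (.inl ⟨rfl, rfl⟩)
    | succ n hn ih => exact (ih (by omega)).trans (hi _ _ (.inl ⟨rfl, rfl⟩))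
  · intro i₁ i₂ j h
    obtain ⟨i₁, h1⟩ := i₁
    obtain ⟨i₂, h2⟩ := i₂
    rw [Fin.mk_lt_mk] at h
    induction i₂, h using Nat.le_induction with
    | base => exact hi _ _ (.inr ⟨rfl, rfl⟩)
    | succ n hn ih => exact (ih (by omega)).trans (hi _ _ (.inr ⟨rfl, rfl⟩))

theorem kpro_inc {a b q : ℕ} {T : Fin a × Fin b → ℕ} (hT : IncTab a b q T) (hq : 1 ≤ q) :
    IncTab a b q (KPro q T) :=
  incTab_of_nx (kpro_pro hT hq).rng (kpro_pro hT hq).inc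

theorem kpro_inj {a b q : ℕ} {T U : Fin a × Fin b → ℕ} (hT : IncTab a b q T)
    (hU : IncTab a b q U) (hq : 1 ≤ q) (h : KPro q T = KPro q U) : T = U := by
  apply sweep_inj (q + 1) (by omega)
  funext x
  have h1 := (inv_final hT hq).rng x
  have h2 := (inv_final hU hq).rng x
  have h3 := congrFun h x
  unfold KPro at h3
  split_ifs at h3 <;> omega

/-- Extend a filling to all natural coordinates. -/
noncomputable def ext {a b : ℕ} (U : Fin a × Fin b → ℕ) (r c : ℕ) : ℤ :=
  if h : r < a ∧ c < b then (U (⟨r, h.1⟩, ⟨c, h.2⟩) : ℤ) else 0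

theorem ext_eq {a b : ℕ} (U : Fin a × Fin b → ℕ) {r c : ℕ} (hr : r < a) (hc : c < b) :
    ext U r c = U (⟨r, hr⟩, ⟨c, hc⟩) := by
  unfold ext
  rw [dif_pos ⟨hr, hc⟩]

theorem fam_of {a b q : ℕ} (V : ℤ → Fin a × Fin b → ℕ) (hV : ∀ i, IncTab a b q (V i))
    (hP : ∀ i, Pro q (V i) (V (i + 1))) : Fam a b q (fun i r c => ext (V i) r c + i) where
  row i r c₁ c₂ hr h1 h2 := by
    rw [ext_eq _ hr h2, ext_eq _ hr (h1.trans h2)]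
    have := (hV i).2.1 ⟨r, hr⟩ ⟨c₁, h1.trans h2⟩ ⟨c₂, h2⟩ h1
    omega
  col i r₁ r₂ c h1 h2 hc := by
    rw [ext_eq _ h2 hc, ext_eq _ (h1.trans h2) hc]
    have := (hV i).2.2 ⟨r₁, h1.trans h2⟩ ⟨r₂, h2⟩ ⟨c, hc⟩ h1
    omega
  lo i r c hr hc := by
    rw [ext_eq _ hr hc]
    have := (hV i).1 (⟨r, hr⟩, ⟨c, hc⟩)
    omega
  hi i r c hr hc := by
    rw [ext_eq _ hr hc]
    have := (hV i).1 (⟨r, hr⟩, ⟨c, hc⟩)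
    omega
  nc i r₁ r₂ c h1 h2 hc := by
    rw [ext_eq _ h2 hc, ext_eq _ (h1.trans h2) hc]
    have := (hP i).le (⟨r₁, h1.trans h2⟩, ⟨c, hc⟩) (⟨r₁ + 1, by omega⟩, ⟨c, hc⟩)
      (.inr ⟨rfl, rfl⟩)
    rcases (show r₁ + 1 ≤ r₂ by omega).eq_or_lt with e | e
    · subst e
      omega
    · have := (hV i).2.2 ⟨r₁ + 1, by omega⟩ ⟨r₂, h2⟩ ⟨c, hc⟩ e
      omega
  nr i r c₁ c₂ hr h1 h2 := by
    rw [ext_eq _ hr h2, ext_eq _ hr (h1.trans h2)]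
    have := (hP i).le (⟨r, hr⟩, ⟨c₁, h1.trans h2⟩) (⟨r, hr⟩, ⟨c₁ + 1, by omega⟩)
      (.inl ⟨rfl, rfl⟩)
    rcases (show c₁ + 1 ≤ c₂ by omega).eq_or_lt with e | e
    · subst e
      omega
    · have := (hV i).2.1 ⟨r, hr⟩ ⟨c₁ + 1, by omega⟩ ⟨c₂, h2⟩ e
      omega
  mono i r c hr hc := by
    rw [ext_eq _ hr hc, ext_eq _ hr hc]
    have := (hP i).ge (⟨r, hr⟩, ⟨c, hc⟩)
    omega
  d i r c hr hc hne := by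
    rw [ext_eq _ hr hc] at *
    rw [ext_eq _ hr hc] at *
    rcases (hP i).d (⟨r, hr⟩, ⟨c, hc⟩) (by omega) with h | ⟨⟨⟨r', hr'⟩, ⟨c', hc'⟩⟩, hn, h⟩
    · left; omega
    · right
      unfold Nx at hn
      simp only [Fin.mk.injEq] at hn
      rcases hn with ⟨rfl, hn⟩ | ⟨rfl, hn⟩
      · refine .inl ⟨c', hn, ?_⟩
        rw [ext_eq _ hr hc']; omega
      · refine .inr ⟨r', hn, ?_⟩
        rw [ext_eq _ hr' hc]; omega
  d' i r c hr hc hne := by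
    rw [ext_eq _ hr hc] at *
    rw [ext_eq _ hr hc] at *
    rcases (hP i).d' (⟨r, hr⟩, ⟨c, hc⟩) (by omega) with h | ⟨⟨⟨r', hr'⟩, ⟨c', hc'⟩⟩, hn, h⟩
    · left; omega
    · right
      unfold Nx at hn
      simp only [Fin.mk.injEq] at hn
      rcases hn with ⟨rfl, rfl⟩ | ⟨rfl, rfl⟩
      · refine .inl ⟨hc', ?_⟩
        rw [ext_eq _ hr hc']; omega
      · refine .inr ⟨hr', ?_⟩
        rw [ext_eq _ hr' hc]; omega

theorem frame_le {a b q : ℕ} (ha : 0 < a) (hb : 0 < b) (V : ℤ → Fin a × Fin b → ℕ)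
    (hV : ∀ i, IncTab a b q (V i)) (hP : ∀ i, Pro q (V i) (V (i + 1)))
    (x : Fin a × Fin b) (hx : InFrame x) (u : ℤ) : V (u + q) x ≤ V u x := by
  have F := fam_of V hV hP
  obtain ⟨⟨r, hr⟩, ⟨c, hc⟩⟩ := x
  unfold InFrame at hx
  dsimp only at hx
  have key : ext (V (u + q)) r c + (u + q) ≤ ext (V u) r c + u + q := by
    rcases hx with rfl | rfl | rfl | rfl
    · exact F.first_row ha u c hc
    · exact F.last_row ha u c hc
    · exact F.transp.first_row hb u r hr
    · exact F.transp.last_row hb u r hr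
  rw [ext_eq _ hr hc, ext_eq _ hr hc] at key
  omega

theorem finite_inc (a b q : ℕ) : Finite {T : Fin a × Fin b → ℕ // IncTab a b q T} := by
  have : ({T : Fin a × Fin b → ℕ | IncTab a b q T}).Finite := by
    apply (Set.Finite.pi (t := fun _ : Fin a × Fin b => Set.Icc 1 q)
      (fun _ => Set.finite_Icc 1 q)).subset
    intro T hT x _
    exact hT.1 x
  exact this

theorem orbit_period {a b q : ℕ} (hq : 1 ≤ q) {T : Fin a × Fin b → ℕ} (hT : IncTab a b q T) :
    0 < (PsiOrbit q T).ncard ∧ (KPro q)^[(PsiOrbit q T).ncard] T = T := by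
  haveI := finite_inc a b q
  let F : {T : Fin a × Fin b → ℕ // IncTab a b q T} → {T : Fin a × Fin b → ℕ // IncTab a b q T} :=
    fun U => ⟨KPro q U.1, kpro_inc U.2 hq⟩
  have hF : Function.Injective F := by
    intro U W h
    exact Subtype.ext (kpro_inj U.2 W.2 hq (congrArg Subtype.val h))
  have hit : ∀ n, (F^[n] ⟨T, hT⟩).1 = (KPro q)^[n] T := by
    intro n
    induction n with
    | zero => rfl
    | succ n ih => rw [Function.iterate_succ_apply', Function.iterate_succ_apply', ← ih]
  have hper : (⟨T, hT⟩ : {T : Fin a × Fin b → ℕ // IncTab a b q T}) ∈ Function.periodicPts F :=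
    hF.mem_periodicPts _
  have hpos := Function.minimalPeriod_pos_of_mem_periodicPts hper
  have hcard : (PsiOrbit q T).ncard = Function.minimalPeriod F ⟨T, hT⟩ := by
    have e : PsiOrbit q T = (fun n => (F^[n] ⟨T, hT⟩).1) ''
        (Set.Iio (Function.minimalPeriod F ⟨T, hT⟩)) := by
      ext U
      constructor
      · rintro ⟨n, rfl⟩
        refine ⟨n % Function.minimalPeriod F ⟨T, hT⟩, Nat.mod_lt _ hpos, ?_⟩
        dsimp only
        rw [Function.iterate_mod_minimalPeriod_eq, hit]
      · rintro ⟨n, -, rfl⟩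
        exact ⟨n, (hit n).symm⟩
    rw [e, Set.ncard_image_of_injOn]
    · rw [← Nat.card_coe_set_eq]; simp
    · intro m hm n hn h
      exact Function.iterate_injOn_Iio_minimalPeriod hm hn (Subtype.ext h)
  rw [hcard]
  refine ⟨hpos, ?_⟩
  rw [← hit, Function.iterate_minimalPeriod]

theorem iter_inc {a b q : ℕ} (hq : 1 ≤ q) {T : Fin a × Fin b → ℕ} (hT : IncTab a b q T)
    (n : ℕ) : IncTab a b q ((KPro q)^[n] T) := by
  induction n with
  | zero => exact hT
  | succ n ih => rw [Function.iterate_succ_apply']; exact kpro_inc ih hq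

theorem frame_iter {a b q k : ℕ} (ha : 0 < a) (hb : 0 < b) (hq : 1 ≤ q)
    {T : Fin a × Fin b → ℕ} (hT : IncTab a b q T) (hk : 0 < k) (hper : (KPro q)^[k] T = T)
    (hgcd : Nat.gcd k q = 1) (x : Fin a × Fin b) (hx : InFrame x) (n : ℕ) :
    (KPro q)^[n] T x = T x := by
  have hk' : (0 : ℤ) < k := by exact_mod_cast hk
  let V : ℤ → Fin a × Fin b → ℕ := fun i => (KPro q)^[(i % k).toNat] T
  have hmod : ∀ m, (KPro q)^[m % k] T = (KPro q)^[m] T := fun m =>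
    Function.IsPeriodicPt.iterate_mod_apply hper m
  have hVnat : ∀ m : ℕ, V m = (KPro q)^[m] T := by
    intro m
    show (KPro q)^[((m : ℤ) % k).toNat] T = _
    rw [← hmod m]
    congr 2
  have hVk : ∀ i j : ℤ, V (i + k * j) = V i := by
    intro i j
    show (KPro q)^[((i + k * j) % k).toNat] T = (KPro q)^[(i % k).toNat] T
    rw [Int.add_mul_emod_self_left]
  have hVs : ∀ i, V (i + 1) = KPro q (V i) := by
    intro i
    have h1 : V (i + 1) = V (((i % k).toNat + 1 : ℕ) : ℤ) := by
      have h0 := Int.emod_nonneg i hk'.ne'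
      rw [← hVk (((i % k).toNat + 1 : ℕ) : ℤ) (i / k)]
      congr 1
      push_cast
      rw [Int.toNat_of_nonneg h0]
      have := Int.emod_add_mul_ediv i k
      linarith
    rw [h1, hVnat, Function.iterate_succ_apply']
  have hV : ∀ i, IncTab a b q (V i) := fun i => iter_inc hq hT _
  have hP : ∀ i, Pro q (V i) (V (i + 1)) := fun i => by
    rw [hVs]; exact kpro_pro (hV i) hq
  have hle := frame_le ha hb V hV hP x hx
  have hle' : ∀ (m : ℕ) (u : ℤ), V (u + q * m) x ≤ V u x := by
    intro m
    induction m with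
    | zero => intro u; simp
    | succ m ih =>
      intro u
      have := hle (u + q * m)
      rw [show u + q * ((m + 1 : ℕ) : ℤ) = u + q * m + q by push_cast; ring]
      exact this.trans (ih u)
  -- by coprimality every shift is a nonnegative multiple of q modulo k
  have hle2 : ∀ u v : ℤ, V v x ≤ V u x := by
    intro u v
    have hbez := Nat.gcd_eq_gcd_ab k q
    rw [hgcd] at hbez
    push_cast at hbez
    obtain ⟨w, hw⟩ : ∃ w : ℤ, w = (v - u) * Nat.gcdB k q := ⟨_, rfl⟩
    have h1 := hle' (w % k).toNat u
    rw [Int.toNat_of_nonneg (Int.emod_nonneg w hk'.ne')] at h1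
    have h2 : v = u + q * (w % k) + k * ((v - u) * Nat.gcdA k q + q * (w / k)) := by
      have h3 := Int.emod_add_mul_ediv w k
      have : (v - u) = (v - u) * (k * Nat.gcdA k q + q * Nat.gcdB k q) := by
        rw [← hbez, mul_one]
      linear_combination this - q * h3 - q * hw
    rw [h2, hVk]
    exact h1
  have h0 := le_antisymm (hle2 (0 : ℕ) (n : ℕ)) (hle2 (n : ℕ) (0 : ℕ))
  rw [hVnat, hVnat] at h0
  exact h0

/-- Let `q ≥ a + b - 1` and `T ∈ Inc^q(a × b)`, and suppose the K-promotion
orbit of `T` has cardinality `k` with `gcd(k, q) = 1`. Then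
`Frame(U) = Frame(T)` for every `U` in the Ψ-orbit of `T`; in particular,
`Frame(T) = Frame(Ψ(T))`. -/
theorem coprime_orbit_frame_constant (a b : ℕ) (ha : 0 < a) (hb : 0 < b)
    (q k : ℕ) (hq : a + b - 1 ≤ q) (T : Fin a × Fin b → ℕ) (hT : IncTab a b q T)
    (hk : (PsiOrbit q T).ncard = k) (hgcd : Nat.gcd k q = 1) :
    (∀ U ∈ PsiOrbit q T, FrameEq U T) ∧ FrameEq T (KPro q T) := by
  have hq1 : 1 ≤ q := by omega
  obtain ⟨hpos, hper⟩ := orbit_period hq1 hT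
  rw [hk] at hpos hper
  have key := fun x hx n => frame_iter ha hb hq1 hT hpos hper hgcd x hx n
  refine ⟨?_, ?_⟩
  · rintro U ⟨n, rfl⟩ x hx
    exact key x hx n
  · intro x hx
    exact (key x hx 1).symm
end
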